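/- In every Markov flow graph with all node probabilities positive, for all 0 ≤ l_1 < l_2 ≤ N: φ(l_1) − φ(l_2) = Σ_{u ∈ L_{l_1}} Σ_{v ∈ L_{l_2}} p(u,v)·(A(u) − A(v))². In particular, the potential function φ is non-increasing in l. -/

import Mathlib

open Finset

/-- A (layered) Markov flow graph: layers `L 0, …, L N` of nodes (pairwise disjoint, nonempty),
an initial distribution `p0` on `L 0`, and transition probabilities `q` supported on pairs of
consecutive layers, with rows summing to `1`. -/
structure MarkovFlow (V : Type) [Fintype V] [DecidableEq V] where
  N : ℕ
  one_le_N : 1 ≤ N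
  L : ℕ → Finset V
  layer_nonempty : ∀ l, l ≤ N → (L l).Nonempty
  layer_disjoint : ∀ l m, l ≤ N → m ≤ N → l ≠ m → Disjoint (L l) (L m)
  p0 : V → ℝ
  p0_nonneg : ∀ u, 0 ≤ p0 u
  p0_supp : ∀ u, u ∉ L 0 → p0 u = 0
  p0_sum : ∑ u ∈ L 0, p0 u = 1
  q : V → V → ℝ
  q_nonneg : ∀ u v, 0 ≤ q u v
  q_le_one : ∀ u v, q u v ≤ 1
  q_supp : ∀ u v, q u v ≠ 0 → ∃ l, l < N ∧ u ∈ L l ∧ v ∈ L (l + 1)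
  q_row : ∀ l, l < N → ∀ u ∈ L l, ∑ v ∈ L (l + 1), q u v = 1

namespace MarkovFlow

variable {V : Type} [Fintype V] [DecidableEq V]

/-- The marginal probability `p(u) = Pr[X_l = u]`. -/
noncomputable def pm (M : MarkovFlow V) : ℕ → V → ℝ
  | 0 => M.p0
  | l + 1 => fun v => ∑ u, pm M l u * M.q u v

/-- The `d`-step transition probability from node `u`. -/
noncomputable def cond (M : MarkovFlow V) (u : V) : ℕ → V → ℝ
  | 0 => fun v => if v = u then 1 else 0
  | d + 1 => fun v => ∑ w, cond M u d w * M.q w v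

/-- The joint probability `p(u,v) = Pr[X_{l₁} = u ∧ X_{l₂} = v]` (for `l₁ ≤ l₂`). -/
noncomputable def pj (M : MarkovFlow V) (l₁ l₂ : ℕ) (u v : V) : ℝ :=
  pm M l₁ u * cond M u (l₂ - l₁) v

/-- `A(v) = Pr[X_0 = s₀ ∣ X_l = v] - 1/2 = p(s₀,v)/p(v) - 1/2`. -/
noncomputable def A (M : MarkovFlow V) (s₀ : V) (l : ℕ) (v : V) : ℝ :=
  pj M 0 l s₀ v / pm M l v - 1 / 2

/-- The potential `φ(l) = Var[A(X_l)]`. -/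
noncomputable def phi (M : MarkovFlow V) (s₀ : V) (l : ℕ) : ℝ :=
  (∑ v ∈ M.L l, pm M l v * (A M s₀ l v) ^ 2) - (∑ v ∈ M.L l, pm M l v * A M s₀ l v) ^ 2

end MarkovFlow

namespace MarkovFlow

section Helpers

variable {V : Type} [Fintype V] [DecidableEq V] (M : MarkovFlow V)

theorem mem_layer_succ_of_q_ne_zero {l : ℕ} (hl : l ≤ M.N) {u v : V} (hu : u ∈ M.L l)
    (h : M.q u v ≠ 0) : v ∈ M.L (l + 1) := by
  obtain ⟨k, hk, huk, hv⟩ := M.q_supp u v h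
  by_cases hkl : k = l
  · exact hkl ▸ hv
  · exact absurd hu (Finset.disjoint_left.mp (M.layer_disjoint k l hk.le hl hkl) huk)

theorem pm_eq_zero_of_notMem {l : ℕ} (hl : l ≤ M.N) {v : V} (hv : v ∉ M.L l) :
    M.pm l v = 0 := by
  induction l generalizing v with
  | zero => exact M.p0_supp v hv
  | succ l ih =>
    refine Finset.sum_eq_zero fun u _ => ?_
    by_cases hu : u ∈ M.L l
    · by_cases hq : M.q u v = 0
      · rw [hq, mul_zero]
      · exact absurd (M.mem_layer_succ_of_q_ne_zero (by omega) hu hq) hv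
    · rw [ih (by omega) hu, zero_mul]

theorem cond_eq_zero_of_notMem {l d : ℕ} (hd : l + d ≤ M.N) {u v : V} (hu : u ∈ M.L l)
    (hv : v ∉ M.L (l + d)) : M.cond u d v = 0 := by
  induction d generalizing v with
  | zero =>
    have h : v ≠ u := fun h => hv (h ▸ hu)
    simp [cond, h]
  | succ d ih =>
    refine Finset.sum_eq_zero fun w _ => ?_
    by_cases hw : w ∈ M.L (l + d)
    · by_cases hq : M.q w v = 0
      · rw [hq, mul_zero]
      · exact absurd (M.mem_layer_succ_of_q_ne_zero (by omega) hw hq) hv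
    · rw [ih (by omega) hw, zero_mul]

theorem cond_nonneg (u : V) (d : ℕ) (v : V) : 0 ≤ M.cond u d v := by
  induction d generalizing v with
  | zero => unfold cond; split_ifs <;> norm_num
  | succ d ih => exact Finset.sum_nonneg fun w _ => mul_nonneg (ih w) (M.q_nonneg w v)

theorem sum_layer_cond {l d : ℕ} (hd : l + d ≤ M.N) {u : V} (hu : u ∈ M.L l) :
    ∑ v ∈ M.L (l + d), M.cond u d v = 1 := by
  induction d with
  | zero => simp [cond, hu]
  | succ d ih =>
    change ∑ v ∈ M.L (l + d + 1), ∑ w, M.cond u d w * M.q w v = 1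
    rw [Finset.sum_comm, ← ih (by omega)]
    simp_rw [← Finset.mul_sum]
    rw [← Finset.sum_subset (Finset.subset_univ (M.L (l + d)))
      fun w _ hw => by rw [M.cond_eq_zero_of_notMem (by omega) hu hw, zero_mul]]
    exact Finset.sum_congr rfl fun w hw => by rw [M.q_row (l + d) (by omega) w hw, mul_one]

theorem sum_pm_mul_cond (l d : ℕ) (v : V) :
    ∑ u, M.pm l u * M.cond u d v = M.pm (l + d) v := by
  induction d generalizing v with
  | zero => simp [cond]
  | succ d ih =>
    change ∑ u, M.pm l u * ∑ w, M.cond u d w * M.q w v = ∑ w, M.pm (l + d) w * M.q w v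
    simp_rw [← ih, Finset.mul_sum, Finset.sum_mul]
    rw [Finset.sum_comm]
    simp_rw [mul_assoc]

theorem sum_cond_mul_cond (s : V) (l d : ℕ) (v : V) :
    ∑ u, M.cond s l u * M.cond u d v = M.cond s (l + d) v := by
  induction d generalizing v with
  | zero => simp [cond]
  | succ d ih =>
    change ∑ u, M.cond s l u * ∑ w, M.cond u d w * M.q w v = ∑ w, M.cond s (l + d) w * M.q w v
    simp_rw [← ih, Finset.mul_sum, Finset.sum_mul]
    rw [Finset.sum_comm]
    simp_rw [mul_assoc]

theorem pm_mul_A {s : V} {l : ℕ} {v : V} (h : M.pm l v ≠ 0) :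
    M.pm l v * M.A s l v = M.p0 s * M.cond s l v - M.pm l v / 2 := by
  simp only [A, pj, pm, Nat.sub_zero]
  field_simp

theorem pj_nonneg {l₁ l₂ : ℕ} {u : V} (h : 0 ≤ M.pm l₁ u) (v : V) : 0 ≤ M.pj l₁ l₂ u v :=
  mul_nonneg h (M.cond_nonneg u _ v)

theorem sum_pj_right {l₁ l₂ : ℕ} (h : l₁ ≤ l₂) (hN : l₂ ≤ M.N) {u : V} (hu : u ∈ M.L l₁) :
    ∑ v ∈ M.L l₂, M.pj l₁ l₂ u v = M.pm l₁ u := by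
  obtain ⟨d, rfl⟩ := Nat.exists_eq_add_of_le h
  simp only [pj, Nat.add_sub_cancel_left]
  rw [← Finset.mul_sum, M.sum_layer_cond hN hu, mul_one]

theorem sum_pj_left {l₁ l₂ : ℕ} (h : l₁ ≤ l₂) (hN : l₂ ≤ M.N) (v : V) :
    ∑ u ∈ M.L l₁, M.pj l₁ l₂ u v = M.pm l₂ v := by
  obtain ⟨d, rfl⟩ := Nat.exists_eq_add_of_le h
  simp only [pj, Nat.add_sub_cancel_left]
  rw [← M.sum_pm_mul_cond]
  exact Finset.sum_subset (Finset.subset_univ _) fun u _ hu => by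
    rw [M.pm_eq_zero_of_notMem (by omega) hu, zero_mul]

/-- The backward martingale property of `A`: `p(v) A(v)` is the sum of `p(u,v) A(u)` over the
nodes `u` of any earlier layer. -/
theorem sum_pj_mul_A {l₁ l₂ : ℕ} (h : l₁ ≤ l₂) (hN : l₂ ≤ M.N) {s : V} (hs : s ∈ M.L 0)
    (hpos : ∀ u ∈ M.L l₁, 0 < M.pm l₁ u) {v : V} (hv : 0 < M.pm l₂ v) :
    ∑ u ∈ M.L l₁, M.pj l₁ l₂ u v * M.A s l₁ u = M.pm l₂ v * M.A s l₂ v := by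
  obtain ⟨d, rfl⟩ := Nat.exists_eq_add_of_le h
  rw [M.pm_mul_A hv.ne', ← M.sum_cond_mul_cond, ← M.sum_pm_mul_cond, Finset.mul_sum,
    Finset.sum_div, ← Finset.sum_sub_distrib]
  simp only [pj, Nat.add_sub_cancel_left]
  rw [← Finset.sum_subset (Finset.subset_univ (M.L l₁))]
  · refine Finset.sum_congr rfl fun u hu => ?_
    rw [mul_right_comm, M.pm_mul_A (hpos u hu).ne']
    ring
  · intro u _ hu
    have hc : M.cond s l₁ u = 0 :=
      M.cond_eq_zero_of_notMem (l := 0) (by omega) hs (by rwa [Nat.zero_add])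
    rw [M.pm_eq_zero_of_notMem (by omega) hu, hc]
    ring

theorem phi_sub_phi {l₁ l₂ : ℕ} (h : l₁ ≤ l₂) (hN : l₂ ≤ M.N) {s : V} (hs : s ∈ M.L 0)
    (hpos₁ : ∀ u ∈ M.L l₁, 0 < M.pm l₁ u) (hpos₂ : ∀ v ∈ M.L l₂, 0 < M.pm l₂ v) :
    M.phi s l₁ - M.phi s l₂ =
      ∑ u ∈ M.L l₁, ∑ v ∈ M.L l₂, M.pj l₁ l₂ u v * (M.A s l₁ u - M.A s l₂ v) ^ 2 := by
  have hback : ∀ v ∈ M.L l₂,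
      ∑ u ∈ M.L l₁, M.pj l₁ l₂ u v * M.A s l₁ u = M.pm l₂ v * M.A s l₂ v :=
    fun v hv => M.sum_pj_mul_A h hN hs hpos₁ (hpos₂ v hv)
  have hmean : ∑ v ∈ M.L l₂, M.pm l₂ v * M.A s l₂ v = ∑ u ∈ M.L l₁, M.pm l₁ u * M.A s l₁ u := by
    rw [← Finset.sum_congr rfl hback, Finset.sum_comm]
    refine Finset.sum_congr rfl fun u hu => ?_
    rw [← Finset.sum_mul, M.sum_pj_right h hN hu]
  have hsq₁ : ∑ u ∈ M.L l₁, ∑ v ∈ M.L l₂, M.pj l₁ l₂ u v * M.A s l₁ u ^ 2 =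
      ∑ u ∈ M.L l₁, M.pm l₁ u * M.A s l₁ u ^ 2 :=
    Finset.sum_congr rfl fun u hu => by rw [← Finset.sum_mul, M.sum_pj_right h hN hu]
  have hsq₂ : ∑ u ∈ M.L l₁, ∑ v ∈ M.L l₂, M.pj l₁ l₂ u v * M.A s l₂ v ^ 2 =
      ∑ v ∈ M.L l₂, M.pm l₂ v * M.A s l₂ v ^ 2 := by
    rw [Finset.sum_comm]
    exact Finset.sum_congr rfl fun v _ => by rw [← Finset.sum_mul, M.sum_pj_left h hN]
  have hcross : ∑ u ∈ M.L l₁, ∑ v ∈ M.L l₂, M.pj l₁ l₂ u v * M.A s l₁ u * M.A s l₂ v =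
      ∑ v ∈ M.L l₂, M.pm l₂ v * M.A s l₂ v ^ 2 := by
    rw [Finset.sum_comm]
    exact Finset.sum_congr rfl fun v hv => by rw [← Finset.sum_mul, hback v hv]; ring
  have hexpand : ∀ u v, M.pj l₁ l₂ u v * (M.A s l₁ u - M.A s l₂ v) ^ 2 =
      M.pj l₁ l₂ u v * M.A s l₁ u ^ 2 + M.pj l₁ l₂ u v * M.A s l₂ v ^ 2
        - 2 * (M.pj l₁ l₂ u v * M.A s l₁ u * M.A s l₂ v) := fun u v => by ring
  simp only [hexpand, Finset.sum_sub_distrib, Finset.sum_add_distrib, ← Finset.mul_sum]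
  rw [hsq₁, hsq₂, hcross, phi, phi, hmean]
  ring

end Helpers

end MarkovFlow

/-- Lemma 6 of the paper: the drop of the potential `φ` between layers equals
the expected squared increment of `A`:
`φ(l₁) − φ(l₂) = ∑_{u ∈ L l₁} ∑_{v ∈ L l₂} p(u,v) (A(u) − A(v))²`.
In particular `φ` is non-increasing. -/
theorem stmt8 (V : Type) [Fintype V] [DecidableEq V]
    (M : MarkovFlow V) (s₀ s₁ t₀ t₁ : V)
    (hL0 : M.L 0 = {s₀, s₁}) (hss : s₀ ≠ s₁)
    (hp0 : M.p0 s₀ = 1 / 2) (hp1 : M.p0 s₁ = 1 / 2)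
    (hLN : M.L M.N = {t₀, t₁}) (htt : t₀ ≠ t₁)
    (hpos : ∀ l, l ≤ M.N → ∀ u ∈ M.L l, 0 < MarkovFlow.pm M l u) :
    (∀ l₁ l₂ : ℕ, l₁ < l₂ → l₂ ≤ M.N →
      MarkovFlow.phi M s₀ l₁ - MarkovFlow.phi M s₀ l₂ =
        ∑ u ∈ M.L l₁, ∑ v ∈ M.L l₂,
          MarkovFlow.pj M l₁ l₂ u v * (MarkovFlow.A M s₀ l₁ u - MarkovFlow.A M s₀ l₂ v) ^ 2) ∧
    (∀ l₁ l₂ : ℕ, l₁ ≤ l₂ → l₂ ≤ M.N →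
      MarkovFlow.phi M s₀ l₂ ≤ MarkovFlow.phi M s₀ l₁) := by
  have hs : s₀ ∈ M.L 0 := by simp [hL0]
  have key : ∀ l₁ l₂ : ℕ, l₁ ≤ l₂ → l₂ ≤ M.N → _ := fun l₁ l₂ h hN =>
    M.phi_sub_phi h hN hs (hpos l₁ (h.trans hN)) (hpos l₂ hN)
  refine ⟨fun l₁ l₂ h hN => key l₁ l₂ h.le hN, fun l₁ l₂ h hN => sub_nonneg.mp ?_⟩
  rw [key l₁ l₂ h hN]
  exact Finset.sum_nonneg fun u hu => Finset.sum_nonneg fun v _ =>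
    mul_nonneg (M.pj_nonneg (hpos l₁ (h.trans hN) u hu).le v) (sq_nonneg _)
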